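/- Let p = (3/1034)³ (a real number) and n = 2²⁰. Then 1 − Σ_{i=0}^{3} (n choose i) · pⁱ · (1−p)^{n−i} ≥ 2^{−26}. -/

import Mathlib

/-- The binomial tail `P(V ≥ k)` is at least the lower bound for `P(V = k)` given by
Bernoulli's inequality. -/
lemma choose_mul_pow_mul_one_sub_le_binomial_tail {n k : ℕ} (hk : k ≤ n) {p : ℝ}
    (hp₀ : 0 ≤ p) (hp₁ : p ≤ 1) :
    (n.choose k : ℝ) * p ^ k * (1 - (n - k : ℕ) * p) ≤
      1 - ∑ i ∈ Finset.range k, (n.choose i : ℝ) * p ^ i * (1 - p) ^ (n - i) := by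
  have hq : 0 ≤ 1 - p := sub_nonneg.2 hp₁
  have total : ∑ i ∈ Finset.range (n + 1), (n.choose i : ℝ) * p ^ i * (1 - p) ^ (n - i) = 1 := by
    have h := add_pow p (1 - p) n
    rw [add_sub_cancel, one_pow] at h
    refine Eq.trans ?_ h.symm
    exact Finset.sum_congr rfl fun i _ => by ring
  have head : ∑ i ∈ Finset.range (k + 1), (n.choose i : ℝ) * p ^ i * (1 - p) ^ (n - i) ≤ 1 := by
    refine le_trans ?_ total.le
    exact Finset.sum_le_sum_of_subset_of_nonneg (Finset.range_mono (Nat.succ_le_succ hk))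
      fun i _ _ => by positivity
  rw [Finset.sum_range_succ] at head
  have bernoulli : 1 - (n - k : ℕ) * p ≤ (1 - p) ^ (n - k) := by
    have h := one_add_mul_le_pow (a := -p) (by linarith) (n - k)
    rw [← sub_eq_add_neg] at h
    linarith
  have := mul_le_mul_of_nonneg_left bernoulli
    (show 0 ≤ (n.choose k : ℝ) * p ^ k by positivity)
  linarith

/-- Leakage probability lower bound for `n = 2²⁰`, `m = 2¹⁰` (so `k = 1034` bins):
`P(V ≥ 4) ≥ 2⁻²⁶` for `V ~ B(n, (3/1034)³)`. -/
theorem leakage_prob_n20_m10 :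
    let p : ℝ := (3 / 1034) ^ 3
    let n : ℕ := 2 ^ 20
    1 - ∑ i ∈ Finset.range 4, (n.choose i : ℝ) * p ^ i * (1 - p) ^ (n - i)
      ≥ (2 : ℝ) ^ (-26 : ℤ) := by
  intro p n
  refine le_trans ?_ (choose_mul_pow_mul_one_sub_le_binomial_tail (n := n) (k := 4) (p := p)
    (by norm_num [n]) (by norm_num [p]) (by norm_num [p]))
  norm_num [n, p, Nat.choose_eq_descFactorial_div_factorial, Nat.descFactorial, Nat.factorial]
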